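/- For every τ > 0, the sampled-data system associated with T, B, and sampling period τ is exponentially stable with decay rate greater than ω if and only if the bounded operator e^{ωτ} Δ_τ is power stable, where Δ_τ := T(τ) + ∫₀^τ T(s)B ds. -/

import Mathlib

open MeasureTheory Filter Set
open scoped Topology Real

variable {X : Type*}

/-- A strongly continuous (C₀) semigroup on a Banach space `X`. -/
def IsC0Semigroup [NormedAddCommGroup X] [NormedSpace ℂ X]
    (T : ℝ → X →L[ℂ] X) : Prop :=
  T 0 = 1 ∧
  (∀ t s : ℝ, 0 ≤ t → 0 ≤ s → T (t + s) = (T t).comp (T s)) ∧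
  (∀ x : X, ContinuousOn (fun t => T t x) (Set.Ici (0 : ℝ)))

/-- `A`, with domain `domA`, is the generator of the semigroup `T`. -/
def IsGenerator [NormedAddCommGroup X] [NormedSpace ℂ X]
    (T : ℝ → X →L[ℂ] X) (domA : Set X) (A : X → X) : Prop :=
  (∀ x : X, x ∈ domA ↔ ∃ y : X,
      Tendsto (fun t : ℝ => t⁻¹ • (T t x - x)) (𝓝[>] (0 : ℝ)) (𝓝 y)) ∧
  (∀ x ∈ domA,
      Tendsto (fun t : ℝ => t⁻¹ • (T t x - x)) (𝓝[>] (0 : ℝ)) (𝓝 (A x)))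

/-- Power stability of a bounded operator. -/
def PowerStable [NormedAddCommGroup X] [NormedSpace ℂ X] (Δ : X →L[ℂ] X) : Prop :=
  ∃ M : ℝ, 1 ≤ M ∧ ∃ θ : ℝ, θ ∈ Set.Ioo (0 : ℝ) 1 ∧ ∀ k : ℕ, ‖Δ ^ k‖ ≤ M * θ ^ k

/-- `x` is the sampled-data solution with initial state `x0`. -/
def IsSdSolution [NormedAddCommGroup X] [NormedSpace ℂ X]
    (T : ℝ → X →L[ℂ] X) (B : X →L[ℂ] X) (τ : ℝ) (x0 : X) (x : ℝ → X) : Prop :=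
  x 0 = x0 ∧
  ∀ (k : ℕ) (t : ℝ), 0 < t → t ≤ τ →
    x (k * τ + t) = T t (x (k * τ)) + ∫ s in (0 : ℝ)..t, T s (B (x (k * τ)))

/-- The sampled-data system is exponentially stable with decay rate greater than `ω`. -/
def SdExpStable [NormedAddCommGroup X] [NormedSpace ℂ X]
    (T : ℝ → X →L[ℂ] X) (B : X →L[ℂ] X) (τ ω : ℝ) : Prop :=
  ∃ M : ℝ, 1 ≤ M ∧ ∃ ω' : ℝ, ω < ω' ∧
    ∀ (x0 : X) (x : ℝ → X), IsSdSolution T B τ x0 x →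
      ∀ t : ℝ, 0 ≤ t → ‖x t‖ ≤ M * Real.exp (-ω' * t) * ‖x0‖

/-- The evolution of the state over one sampling interval: `T(t) + ∫₀ᵗ T(s)B ds`. -/
noncomputable def sdFlow [NormedAddCommGroup X] [NormedSpace ℂ X]
    (T : ℝ → X →L[ℂ] X) (B : X →L[ℂ] X) (t : ℝ) (x : X) : X :=
  T t x + ∫ s in (0 : ℝ)..t, T s (B x)

/-- A strongly continuous semigroup is uniformly bounded on compact intervals. -/
theorem IsC0Semigroup.exists_norm_le [NormedAddCommGroup X] [NormedSpace ℂ X] [CompleteSpace X]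
    {T : ℝ → X →L[ℂ] X} (hT : IsC0Semigroup T) (τ : ℝ) :
    ∃ C : ℝ, 0 ≤ C ∧ ∀ t ∈ Icc 0 τ, ‖T t‖ ≤ C := by
  obtain ⟨C, hC⟩ := banach_steinhaus (g := fun t : Icc (0 : ℝ) τ => T t) fun x => by
    obtain ⟨C, hC⟩ := isCompact_Icc.exists_bound_of_continuousOn
      ((hT.2.2 x).mono Icc_subset_Ici_self)
    exact ⟨C, fun t => hC t t.2⟩
  exact ⟨max C 0, le_max_right _ _, fun t ht => (hC ⟨t, ht⟩).trans (le_max_left _ _)⟩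

theorem IsC0Semigroup.exists_norm_sdFlow_le [NormedAddCommGroup X] [NormedSpace ℂ X]
    [CompleteSpace X] {T : ℝ → X →L[ℂ] X} (hT : IsC0Semigroup T) (B : X →L[ℂ] X) {τ : ℝ}
    (hτ : 0 ≤ τ) :
    ∃ K : ℝ, 0 ≤ K ∧ ∀ t ∈ Icc 0 τ, ∀ x, ‖sdFlow T B t x‖ ≤ K * ‖x‖ := by
  obtain ⟨C, hC0, hC⟩ := hT.exists_norm_le τ
  refine ⟨C + C * ‖B‖ * τ, by positivity, fun t ht x => ?_⟩
  have hint : ‖∫ s in (0 : ℝ)..t, T s (B x)‖ ≤ C * (‖B‖ * ‖x‖) * |t - 0| := by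
    refine intervalIntegral.norm_integral_le_of_norm_le_const fun s hs => ?_
    rw [uIoc_of_le ht.1] at hs
    exact (T s).le_of_opNorm_le_of_le (hC s ⟨hs.1.le, hs.2.trans ht.2⟩) (B.le_opNorm x)
  rw [sub_zero, abs_of_nonneg ht.1] at hint
  calc ‖sdFlow T B t x‖ ≤ C * ‖x‖ + C * (‖B‖ * ‖x‖) * t :=
        norm_add_le_of_le ((T t).le_of_opNorm_le (hC t ht) x) hint
    _ ≤ C * ‖x‖ + C * (‖B‖ * ‖x‖) * τ := by gcongr; exact ht.2
    _ = (C + C * ‖B‖ * τ) * ‖x‖ := by ring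

/-- At the sampling times, the sampled-data solution is given by the powers of `Δ_τ`. -/
theorem IsSdSolution.apply_natCast_mul [NormedAddCommGroup X] [NormedSpace ℂ X]
    {T : ℝ → X →L[ℂ] X} {B Δτ : X →L[ℂ] X} {τ : ℝ} {x0 : X} {x : ℝ → X}
    (hx : IsSdSolution T B τ x0 x) (hτ : 0 < τ) (hΔ : ∀ y, Δτ y = sdFlow T B τ y) (k : ℕ) :
    x (k * τ) = (Δτ ^ k) x0 := by
  induction k with
  | zero => simpa using hx.1
  | succ k ih =>
    rw [pow_succ', mul_apply_eq_comp, ← ih, hΔ, Nat.cast_succ, add_one_mul]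
    exact hx.2 k τ hτ le_rfl

theorem natCeil_add_div_sub_one {τ t : ℝ} (hτ : 0 < τ) (k : ℕ) (ht0 : 0 < t) (ht : t ≤ τ) :
    ⌈(k * τ + t) / τ⌉₊ - 1 = k := by
  have h : ⌈(k * τ + t) / τ⌉₊ = k + 1 := by
    rw [Nat.ceil_eq_iff k.succ_ne_zero]
    constructor
    · rw [lt_div_iff₀ hτ]
      simpa using ht0
    · rw [div_le_iff₀ hτ]
      push_cast
      linarith
  rw [h, Nat.add_sub_cancel]

theorem exists_mem_Ioc_eq_natCast_mul_add {τ t : ℝ} (hτ : 0 < τ) (ht : 0 < t) :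
    ∃ k : ℕ, ∃ s ∈ Ioc 0 τ, t = k * τ + s := by
  obtain ⟨k, hk⟩ : ∃ k, ⌈t / τ⌉₊ = k + 1 :=
    Nat.exists_eq_succ_of_ne_zero (Nat.ceil_pos.2 (div_pos ht hτ)).ne'
  rw [Nat.ceil_eq_iff k.succ_ne_zero, lt_div_iff₀ hτ, div_le_iff₀ hτ] at hk
  push_cast at hk
  exact ⟨k, t - k * τ, ⟨by linarith, by linarith⟩, by ring⟩

/-- Every initial state admits a sampled-data solution. -/
theorem exists_isSdSolution [NormedAddCommGroup X] [NormedSpace ℂ X]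
    {T : ℝ → X →L[ℂ] X} (hT : T 0 = 1) {B Δτ : X →L[ℂ] X} {τ : ℝ} (hτ : 0 < τ)
    (hΔ : ∀ y, Δτ y = sdFlow T B τ y) (x0 : X) :
    ∃ x : ℝ → X, IsSdSolution T B τ x0 x := by
  let x : ℝ → X := fun t =>
    sdFlow T B (t - (⌈t / τ⌉₊ - 1 : ℕ) * τ) ((Δτ ^ (⌈t / τ⌉₊ - 1)) x0)
  have hx0 : x 0 = x0 := by simp [x, sdFlow, hT]
  have hstep (k : ℕ) (t : ℝ) (ht0 : 0 < t) (ht : t ≤ τ) :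
      x (k * τ + t) = sdFlow T B t ((Δτ ^ k) x0) := by
    simp only [x, natCeil_add_div_sub_one hτ k ht0 ht, add_sub_cancel_left]
  have hsample (k : ℕ) : x (k * τ) = (Δτ ^ k) x0 := by
    cases k with
    | zero => simpa using hx0
    | succ k =>
      rw [Nat.cast_succ, add_one_mul, hstep k τ hτ le_rfl, ← hΔ, pow_succ',
        mul_apply_eq_comp]
  refine ⟨x, hx0, fun k t ht0 ht => ?_⟩
  rw [hstep k t ht0 ht, hsample, sdFlow]

/-- The sampled-data system is exponentially stable with decay rate greater than `ω`
iff `e^{ωτ} Δ_τ` is power stable, where `Δ_τ = T(τ) + ∫₀^τ T(s)B ds`. -/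
theorem sd_exp_stable_iff_power_stable
    [NormedAddCommGroup X] [NormedSpace ℂ X] [CompleteSpace X]
    (T : ℝ → X →L[ℂ] X) (hT : IsC0Semigroup T)
    (B : X →L[ℂ] X) (τ ω : ℝ) (hτ : 0 < τ)
    (Δτ : X →L[ℂ] X)
    (hΔ : ∀ x : X, Δτ x = T τ x + ∫ s in (0 : ℝ)..τ, T s (B x)) :
    SdExpStable T B τ ω ↔ PowerStable (Real.exp (ω * τ) • Δτ) := by
  have hΔ' : ∀ y, Δτ y = sdFlow T B τ y := hΔ
  have hnorm (k : ℕ) :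
      ‖(Real.exp (ω * τ) • Δτ) ^ k‖ = Real.exp (ω * τ) ^ k * ‖Δτ ^ k‖ := by
    rw [smul_pow, norm_smul, Real.norm_of_nonneg (by positivity)]
  constructor
  · rintro ⟨M, hM, ω', hω, h⟩
    refine ⟨M, hM, Real.exp ((ω - ω') * τ), ⟨Real.exp_pos _, ?_⟩, fun k => ?_⟩
    · exact Real.exp_lt_one_iff.2 (mul_neg_of_neg_of_pos (sub_neg.2 hω) hτ)
    · have hk : ‖Δτ ^ k‖ ≤ M * Real.exp (-ω' * (k * τ)) := by
        refine ContinuousLinearMap.opNorm_le_bound _ (by positivity) fun x0 => ?_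
        obtain ⟨x, hx⟩ := exists_isSdSolution hT.1 hτ hΔ' x0
        rw [← hx.apply_natCast_mul hτ hΔ' k]
        exact h x0 x hx _ (by positivity)
      calc ‖(Real.exp (ω * τ) • Δτ) ^ k‖
          ≤ Real.exp (ω * τ) ^ k * (M * Real.exp (-ω' * (k * τ))) := by
            rw [hnorm]; gcongr
        _ = M * Real.exp ((ω - ω') * τ) ^ k := by
            rw [mul_left_comm, ← Real.exp_nat_mul, ← Real.exp_nat_mul, ← Real.exp_add]
            ring_nf
  · rintro ⟨M, hM, θ, ⟨hθ0, hθ1⟩, h⟩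
    obtain ⟨K, hK0, hK⟩ := hT.exists_norm_sdFlow_le B hτ.le
    obtain ⟨ω', hω'⟩ : ∃ ω', ω' = ω - Real.log θ / τ := ⟨_, rfl⟩
    have hθ : θ = Real.exp ((ω - ω') * τ) := by
      rw [hω', sub_sub_cancel, div_mul_cancel₀ _ hτ.ne', Real.exp_log hθ0]
    have hpow (k : ℕ) : ‖Δτ ^ k‖ ≤ M * Real.exp (-ω' * (k * τ)) := by
      have hk := h k
      rw [hnorm] at hk
      refine le_of_mul_le_mul_left (hk.trans_eq ?_)
        (pow_pos (Real.exp_pos (ω * τ)) k)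
      rw [hθ, mul_left_comm, ← Real.exp_nat_mul, ← Real.exp_nat_mul, ← Real.exp_add]
      ring_nf
    refine ⟨max 1 (K * M * Real.exp (|ω'| * τ)), le_max_left _ _, ω', ?_,
      fun x0 x hx t ht => ?_⟩
    · rw [hω']
      linarith [div_neg_of_neg_of_pos (Real.log_neg hθ0 hθ1) hτ]
    rcases ht.eq_or_lt with rfl | ht
    · rw [hx.1, mul_zero, Real.exp_zero, mul_one]
      exact le_mul_of_one_le_left (norm_nonneg _) (le_max_left _ _)
    obtain ⟨k, s, hs, rfl⟩ := exists_mem_Ioc_eq_natCast_mul_add hτ ht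
    have hexp : Real.exp (-ω' * (k * τ)) ≤
        Real.exp (|ω'| * τ) * Real.exp (-ω' * (k * τ + s)) := by
      rw [← Real.exp_add, Real.exp_le_exp]
      have hωs : ω' * s ≤ |ω'| * τ :=
        mul_le_mul (le_abs_self _) hs.2 hs.1.le (abs_nonneg _)
      linarith
    have hflow : x (k * τ + s) = sdFlow T B s ((Δτ ^ k) x0) := by
      rw [← hx.apply_natCast_mul hτ hΔ' k]
      exact hx.2 k s hs.1 hs.2
    calc ‖x (k * τ + s)‖ ≤ K * ‖(Δτ ^ k) x0‖ := by
          rw [hflow]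
          exact hK s ⟨hs.1.le, hs.2⟩ _
      _ ≤ K * ((M * (Real.exp (|ω'| * τ) * Real.exp (-ω' * (k * τ + s)))) * ‖x0‖) := by
          refine mul_le_mul_of_nonneg_left ?_ hK0
          exact (Δτ ^ k).le_of_opNorm_le ((hpow k).trans (by gcongr)) x0
      _ = K * M * Real.exp (|ω'| * τ) * Real.exp (-ω' * (k * τ + s)) * ‖x0‖ := by ring
      _ ≤ max 1 (K * M * Real.exp (|ω'| * τ)) * Real.exp (-ω' * (k * τ + s)) * ‖x0‖ := by
          gcongr
          exact le_max_right _ _
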